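/- For every λ ∈ 𝔫*, if the character ξ_λ is irreducible then ξ_λ equals the Kirillov function ψ_λ. -/

import Mathlib

open scoped Classical BigOperators ComplexOrder

set_option linter.unusedSectionVars false
set_option linter.unusedVariables false

noncomputable section

namespace IterChar

/-! ### Generic notions for finite groups: inner product, induction, characters -/

/-- The standard inner product `⟨f,h⟩_G = |G|⁻¹ ∑_{x ∈ G} f x * conj (h x)`. -/
def innerG (G : Type) [Group G] (f h : G → ℂ) : ℂ :=
  (Nat.card G : ℂ)⁻¹ * ∑ᶠ x : G, f x * (starRingEnd ℂ) (h x)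

/-- Induction of a function from a subgroup, via the Frobenius formula. -/
def indFun {G : Type} [Group G] (H : Subgroup G) (ψ : ↥H → ℂ) : G → ℂ :=
  fun g => (Nat.card ↥H : ℂ)⁻¹ *
    ∑ᶠ x : G, if h : x * g * x⁻¹ ∈ H then ψ ⟨x * g * x⁻¹, h⟩ else 0

/-- A function `G → ℂ` is a character if it is the trace character of some
finite-dimensional complex representation. -/
def IsCharacter (G : Type) [Group G] (f : G → ℂ) : Prop :=
  ∃ V : FDRep ℂ G, f = FDRep.character V

/-- The set of irreducible characters of `G`: characters of norm one. -/
def Irr (G : Type) [Group G] : Set (G → ℂ) :=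
  {f | IsCharacter G f ∧ innerG G f f = 1}

/-- The set of irreducible constituents of `χ`: irreducible characters with
`⟨χ, ψ⟩_G > 0` (using the complex partial order). -/
def IrrConstituents (G : Type) [Group G] (χ : G → ℂ) : Set (G → ℂ) :=
  {f | f ∈ Irr G ∧ 0 < innerG G χ f}

/-! ### Algebra groups -/

variable {F : Type} [Field F] [Fintype F] {R : Type} [Ring R] [Algebra F R] [Fintype R]

/-- `J` is a nilpotent (non-unital) subalgebra: all products of some fixed length vanish. -/
def IsNil (J : NonUnitalSubalgebra F R) : Prop :=
  ∃ N : ℕ, ∀ l : List R, (∀ x ∈ l, x ∈ J) → l.length = N → l.prod = 0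

/-- The algebra group `G = 1 + J` of a (nilpotent) subalgebra `J ⊆ R`, realized as the
subgroup of units `u` of `R` with `u - 1 ∈ J` (and `u⁻¹ - 1 ∈ J`, which is automatic
when `J` is nilpotent). -/
def algGroup (F : Type) [Field F] [Fintype F] (R : Type) [Ring R] [Algebra F R] [Fintype R]
    (J : NonUnitalSubalgebra F R) : Subgroup Rˣ where
  carrier := {u : Rˣ | ((u : R) - 1 ∈ J) ∧ (((u⁻¹ : Rˣ) : R) - 1 ∈ J)}
  one_mem' := by
    constructor <;> · simp only [Units.val_one, inv_one, sub_self]; exact J.zero_mem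
  mul_mem' := by
    rintro u v ⟨hu1, hu2⟩ ⟨hv1, hv2⟩
    constructor
    · have h : ((u * v : Rˣ) : R) - 1 =
          ((u : R) - 1) * ((v : R) - 1) + ((u : R) - 1) + ((v : R) - 1) := by
        push_cast; noncomm_ring
      rw [h]
      exact add_mem (add_mem (mul_mem hu1 hv1) hu1) hv1
    · have h : (((u * v)⁻¹ : Rˣ) : R) - 1 =
          (((v⁻¹ : Rˣ) : R) - 1) * (((u⁻¹ : Rˣ) : R) - 1) +
            (((v⁻¹ : Rˣ) : R) - 1) + (((u⁻¹ : Rˣ) : R) - 1) := by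
        rw [mul_inv_rev]; push_cast; noncomm_ring
      rw [h]
      exact add_mem (add_mem (mul_mem hv2 hu2) hv2) hu2
  inv_mem' := by
    rintro u ⟨h1, h2⟩
    exact ⟨h2, by simpa using h1⟩

theorem mem_algGroup {J : NonUnitalSubalgebra F R} {u : Rˣ} :
    u ∈ algGroup F R J ↔ ((u : R) - 1 ∈ J) ∧ (((u⁻¹ : Rˣ) : R) - 1 ∈ J) :=
  Iff.rfl

/-- The element `X ∈ J` such that `g = 1 + X`. -/
def gElt {J : NonUnitalSubalgebra F R} (g : ↥(algGroup F R J)) : ↥J :=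
  ⟨((g : Rˣ) : R) - 1, g.2.1⟩

/-- The function `θ_λ(1+X) = θ(λ(X))` on the algebra group `1 + J`. -/
def thetaFn (θ : AddChar F ℂ) (J : NonUnitalSubalgebra F R) (lam : ↥J →ₗ[F] F) :
    ↥(algGroup F R J) → ℂ :=
  fun g => θ (lam (gElt g))

/-- Left multiplication by the group element `g` as a linear endomorphism of `J`. -/
def lmulMap {J : NonUnitalSubalgebra F R} (g : ↥(algGroup F R J)) : ↥J →ₗ[F] ↥J where
  toFun X := ⟨((g : Rˣ) : R) * (X : R), by
    have h : ((g : Rˣ) : R) * (X : R) = (((g : Rˣ) : R) - 1) * (X : R) + (X : R) := by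
      noncomm_ring
    rw [h]; exact add_mem (mul_mem g.2.1 X.2) X.2⟩
  map_add' X Y := by ext; simp [mul_add]
  map_smul' c X := by ext; simp [mul_smul_comm]

/-- Right multiplication by the group element `g` as a linear endomorphism of `J`. -/
def rmulMap {J : NonUnitalSubalgebra F R} (g : ↥(algGroup F R J)) : ↥J →ₗ[F] ↥J where
  toFun X := ⟨(X : R) * ((g : Rˣ) : R), by
    have h : (X : R) * ((g : Rˣ) : R) = (X : R) * (((g : Rˣ) : R) - 1) + (X : R) := by
      noncomm_ring
    rw [h]; exact add_mem (mul_mem X.2 g.2.1) X.2⟩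
  map_add' X Y := by ext; simp [add_mul]
  map_smul' c X := by ext; simp [smul_mul_assoc]

/-- The left action of `G` on the dual space: `(gλ)(X) = λ(g⁻¹ X)`. -/
def leftAct {J : NonUnitalSubalgebra F R} (g : ↥(algGroup F R J)) (lam : ↥J →ₗ[F] F) :
    ↥J →ₗ[F] F :=
  lam.comp (lmulMap g⁻¹)

/-- The right action of `G` on the dual space: `(λg)(X) = λ(X g⁻¹)`. -/
def rightAct {J : NonUnitalSubalgebra F R} (g : ↥(algGroup F R J)) (lam : ↥J →ₗ[F] F) :
    ↥J →ₗ[F] F :=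
  lam.comp (rmulMap g⁻¹)

/-- The coadjoint action of `G` on the dual space: `λ^g(X) = λ(g X g⁻¹)`. -/
def coAct {J : NonUnitalSubalgebra F R} (g : ↥(algGroup F R J)) (lam : ↥J →ₗ[F] F) :
    ↥J →ₗ[F] F :=
  lam.comp ((lmulMap g).comp (rmulMap g⁻¹))

/-- The left orbit `Gλ`. -/
def leftOrbit (J : NonUnitalSubalgebra F R) (lam : ↥J →ₗ[F] F) : Set (↥J →ₗ[F] F) :=
  Set.range fun g : ↥(algGroup F R J) => leftAct g lam

/-- The right orbit `λG`. -/
def rightOrbit (J : NonUnitalSubalgebra F R) (lam : ↥J →ₗ[F] F) : Set (↥J →ₗ[F] F) :=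
  Set.range fun g : ↥(algGroup F R J) => rightAct g lam

/-- The two-sided orbit `GλG`. -/
def twoOrbit (J : NonUnitalSubalgebra F R) (lam : ↥J →ₗ[F] F) : Set (↥J →ₗ[F] F) :=
  {mu | ∃ g h : ↥(algGroup F R J), mu = leftAct g (rightAct h lam)}

/-- The coadjoint orbit `λ^G`. -/
def coOrbit (J : NonUnitalSubalgebra F R) (lam : ↥J →ₗ[F] F) : Set (↥J →ₗ[F] F) :=
  Set.range fun g : ↥(algGroup F R J) => coAct g lam

/-- The right orbit of `λ` under a subgroup `H` of the algebra group. -/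
def rightOrbitUnder (J : NonUnitalSubalgebra F R) (H : Subgroup ↥(algGroup F R J))
    (lam : ↥J →ₗ[F] F) : Set (↥J →ₗ[F] F) :=
  {mu | ∃ s ∈ H, mu = rightAct s lam}

/-- The Kirillov function `ψ_λ = |λ^G|^{-1/2} ∑_{μ ∈ λ^G} θ_μ`. -/
def kirillov (θ : AddChar F ℂ) (J : NonUnitalSubalgebra F R) (lam : ↥J →ₗ[F] F) :
    ↥(algGroup F R J) → ℂ :=
  fun g => ((Real.sqrt (Nat.card ↥(coOrbit J lam)) : ℂ))⁻¹ *
    ∑ᶠ mu ∈ coOrbit J lam, thetaFn θ J mu g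

/-- The supercharacter `χ_λ = (|Gλ|/|GλG|) ∑_{μ ∈ GλG} θ_μ`. -/
def superchar (θ : AddChar F ℂ) (J : NonUnitalSubalgebra F R) (lam : ↥J →ₗ[F] F) :
    ↥(algGroup F R J) → ℂ :=
  fun g => ((Nat.card ↥(leftOrbit J lam) : ℂ) / (Nat.card ↥(twoOrbit J lam) : ℂ)) *
    ∑ᶠ mu ∈ twoOrbit J lam, thetaFn θ J mu g

/-! ### The subalgebras `𝔩_λ`, `𝔰_λ` and their iterates -/

/-- The extension of `λ : J → F` by zero to all of `R`. -/
def lamE (J : NonUnitalSubalgebra F R) (lam : ↥J →ₗ[F] F) (x : R) : F :=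
  if h : x ∈ J then lam ⟨x, h⟩ else 0

theorem lamE_apply (J : NonUnitalSubalgebra F R) (lam : ↥J →ₗ[F] F) {x : R} (hx : x ∈ J) :
    lamE J lam x = lam ⟨x, hx⟩ := dif_pos hx

theorem lamE_zero (J : NonUnitalSubalgebra F R) (lam : ↥J →ₗ[F] F) : lamE J lam 0 = 0 := by
  rw [lamE_apply J lam J.zero_mem]
  have h : (⟨(0 : R), J.zero_mem⟩ : ↥J) = 0 := Subtype.ext rfl
  rw [h, map_zero]

theorem lamE_add (J : NonUnitalSubalgebra F R) (lam : ↥J →ₗ[F] F) {x y : R}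
    (hx : x ∈ J) (hy : y ∈ J) : lamE J lam (x + y) = lamE J lam x + lamE J lam y := by
  rw [lamE, lamE, lamE, dif_pos (add_mem hx hy), dif_pos hx, dif_pos hy]
  have h : (⟨x + y, add_mem hx hy⟩ : ↥J) = ⟨x, hx⟩ + ⟨y, hy⟩ := Subtype.ext rfl
  rw [h, map_add]

theorem lamE_smul (J : NonUnitalSubalgebra F R) (lam : ↥J →ₗ[F] F) (c : F) {x : R}
    (hx : x ∈ J) : lamE J lam (c • x) = c * lamE J lam x := by
  rw [lamE, lamE, dif_pos (SMulMemClass.smul_mem c hx), dif_pos hx]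
  have h : (⟨c • x, SMulMemClass.smul_mem c hx⟩ : ↥J) = c • ⟨x, hx⟩ := Subtype.ext rfl
  rw [h, map_smul]
  rfl

/-- The left kernel `𝔩` of the bilinear form `(X,Y) ↦ λ(XY)` restricted to `s × s`. -/
def lStep (J : NonUnitalSubalgebra F R) (lam : ↥J →ₗ[F] F)
    (s : NonUnitalSubalgebra F R) (hs : s ≤ J) : NonUnitalSubalgebra F R where
  carrier := {x | x ∈ s ∧ ∀ y ∈ s, lamE J lam (x * y) = 0}
  zero_mem' := ⟨zero_mem s, fun y _ => by rw [zero_mul, lamE_zero]⟩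
  add_mem' := by
    rintro a b ⟨ha1, ha2⟩ ⟨hb1, hb2⟩
    refine ⟨add_mem ha1 hb1, fun y hy => ?_⟩
    rw [add_mul, lamE_add J lam (J.mul_mem (hs ha1) (hs hy)) (J.mul_mem (hs hb1) (hs hy)),
      ha2 y hy, hb2 y hy, add_zero]
  smul_mem' := by
    rintro c a ⟨ha1, ha2⟩
    refine ⟨SMulMemClass.smul_mem c ha1, fun y hy => ?_⟩
    rw [smul_mul_assoc, lamE_smul J lam c (J.mul_mem (hs ha1) (hs hy)), ha2 y hy, mul_zero]
  mul_mem' := by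
    rintro a b ⟨ha1, ha2⟩ ⟨hb1, hb2⟩
    refine ⟨mul_mem ha1 hb1, fun y hy => ?_⟩
    rw [mul_assoc]
    exact ha2 (b * y) (mul_mem hb1 hy)

theorem lStep_le (J : NonUnitalSubalgebra F R) (lam : ↥J →ₗ[F] F)
    (s : NonUnitalSubalgebra F R) (hs : s ≤ J) : lStep J lam s hs ≤ s :=
  fun _ hx => hx.1

/-- The left kernel `𝔰` of the bilinear form `(X,Y) ↦ λ(XY)` restricted to `s × 𝔩`. -/
def sStep (J : NonUnitalSubalgebra F R) (lam : ↥J →ₗ[F] F)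
    (s : NonUnitalSubalgebra F R) (hs : s ≤ J) : NonUnitalSubalgebra F R where
  carrier := {x | x ∈ s ∧ ∀ y ∈ lStep J lam s hs, lamE J lam (x * y) = 0}
  zero_mem' := ⟨zero_mem s, fun y _ => by rw [zero_mul, lamE_zero]⟩
  add_mem' := by
    rintro a b ⟨ha1, ha2⟩ ⟨hb1, hb2⟩
    refine ⟨add_mem ha1 hb1, fun y hy => ?_⟩
    rw [add_mul, lamE_add J lam (J.mul_mem (hs ha1) (hs hy.1)) (J.mul_mem (hs hb1) (hs hy.1)),
      ha2 y hy, hb2 y hy, add_zero]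
  smul_mem' := by
    rintro c a ⟨ha1, ha2⟩
    refine ⟨SMulMemClass.smul_mem c ha1, fun y hy => ?_⟩
    rw [smul_mul_assoc, lamE_smul J lam c (J.mul_mem (hs ha1) (hs hy.1)), ha2 y hy, mul_zero]
  mul_mem' := by
    rintro a b ⟨ha1, ha2⟩ ⟨hb1, hb2⟩
    refine ⟨mul_mem ha1 hb1, fun y hy => ?_⟩
    rw [mul_assoc]
    refine ha2 (b * y) ⟨mul_mem hb1 hy.1, fun z hz => ?_⟩
    rw [mul_assoc]
    refine hb2 (y * z) ⟨mul_mem hy.1 hz, fun w hw => ?_⟩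
    rw [mul_assoc]
    exact hy.2 (z * w) (mul_mem hz hw)

theorem sStep_le (J : NonUnitalSubalgebra F R) (lam : ↥J →ₗ[F] F)
    (s : NonUnitalSubalgebra F R) (hs : s ≤ J) : sStep J lam s hs ≤ s :=
  fun _ hx => hx.1

/-- `𝔩_λ`: the left kernel of `(X,Y) ↦ λ(XY)` on `J × J`. -/
def lone (J : NonUnitalSubalgebra F R) (lam : ↥J →ₗ[F] F) : NonUnitalSubalgebra F R :=
  lStep J lam J le_rfl

/-- `𝔰_λ`: the left kernel of `(X,Y) ↦ λ(XY)` on `J × 𝔩_λ`. -/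
def sone (J : NonUnitalSubalgebra F R) (lam : ↥J →ₗ[F] F) : NonUnitalSubalgebra F R :=
  sStep J lam J le_rfl

theorem lone_le (J : NonUnitalSubalgebra F R) (lam : ↥J →ₗ[F] F) : lone J lam ≤ J :=
  lStep_le J lam J le_rfl

theorem sone_le (J : NonUnitalSubalgebra F R) (lam : ↥J →ₗ[F] F) : sone J lam ≤ J :=
  sStep_le J lam J le_rfl

/-- `𝔨_λ = 𝔩_λ ∩ ker λ`. -/
def kone (J : NonUnitalSubalgebra F R) (lam : ↥J →ₗ[F] F) : NonUnitalSubalgebra F R where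
  carrier := {x | x ∈ lone J lam ∧ lamE J lam x = 0}
  zero_mem' := ⟨zero_mem _, lamE_zero J lam⟩
  add_mem' := by
    rintro a b ⟨ha1, ha2⟩ ⟨hb1, hb2⟩
    exact ⟨add_mem ha1 hb1, by
      rw [lamE_add J lam (lone_le J lam ha1) (lone_le J lam hb1), ha2, hb2, add_zero]⟩
  smul_mem' := by
    rintro c a ⟨ha1, ha2⟩
    exact ⟨SMulMemClass.smul_mem c ha1, by
      rw [lamE_smul J lam c (lone_le J lam ha1), ha2, mul_zero]⟩
  mul_mem' := by
    rintro a b ⟨ha1, ha2⟩ ⟨hb1, hb2⟩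
    exact ⟨mul_mem ha1 hb1, ha1.2 b (lone_le J lam hb1)⟩

theorem kone_le (J : NonUnitalSubalgebra F R) (lam : ↥J →ₗ[F] F) : kone J lam ≤ lone J lam :=
  fun _ hx => hx.1

/-- The descending chain `𝔰_λ^0 ⊇ 𝔰_λ^1 ⊇ ⋯` (bundled with the proof `𝔰_λ^i ≤ J`). -/
def sChainAux (J : NonUnitalSubalgebra F R) (lam : ↥J →ₗ[F] F) :
    ℕ → {s : NonUnitalSubalgebra F R // s ≤ J}
  | 0 => ⟨J, le_rfl⟩
  | n + 1 =>
    ⟨sStep J lam (sChainAux J lam n).1 (sChainAux J lam n).2,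
      le_trans (sStep_le J lam (sChainAux J lam n).1 (sChainAux J lam n).2)
        (sChainAux J lam n).2⟩

/-- `𝔰_λ^i`. -/
def sChain (J : NonUnitalSubalgebra F R) (lam : ↥J →ₗ[F] F) (i : ℕ) :
    NonUnitalSubalgebra F R :=
  (sChainAux J lam i).1

/-- `𝔩_λ^{i+1}`. -/
def lChain (J : NonUnitalSubalgebra F R) (lam : ↥J →ₗ[F] F) (i : ℕ) :
    NonUnitalSubalgebra F R :=
  lStep J lam (sChainAux J lam i).1 (sChainAux J lam i).2

/-- The terminal element `𝔰̄_λ` of the descending chain; the chain has stabilized by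
stage `|R|` since it is a weakly decreasing chain of subalgebras of the finite algebra. -/
def sbar (J : NonUnitalSubalgebra F R) (lam : ↥J →ₗ[F] F) : NonUnitalSubalgebra F R :=
  sChain J lam (Fintype.card R)

theorem sbar_le (J : NonUnitalSubalgebra F R) (lam : ↥J →ₗ[F] F) : sbar J lam ≤ J :=
  (sChainAux J lam (Fintype.card R)).2

/-- The terminal element `𝔩̄_λ` of the ascending chain. -/
def lbar (J : NonUnitalSubalgebra F R) (lam : ↥J →ₗ[F] F) : NonUnitalSubalgebra F R :=
  lStep J lam (sbar J lam) (sbar_le J lam)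

theorem lbar_le (J : NonUnitalSubalgebra F R) (lam : ↥J →ₗ[F] F) : lbar J lam ≤ J :=
  le_trans (lStep_le J lam _ _) (sbar_le J lam)

/-! ### Algebra subgroups of an algebra group -/

/-- The algebra subgroup `1 + k` of `1 + J`, as a subgroup of the ambient algebra group. -/
def algSubgroup (k J : NonUnitalSubalgebra F R) : Subgroup ↥(algGroup F R J) :=
  (algGroup F R k).subgroupOf (algGroup F R J)

/-- `L_λ = 1 + 𝔩_λ` as a subgroup of `G`. -/
def Lgrp (J : NonUnitalSubalgebra F R) (lam : ↥J →ₗ[F] F) : Subgroup ↥(algGroup F R J) :=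
  algSubgroup (lone J lam) J

/-- `S_λ = 1 + 𝔰_λ` as a subgroup of `G`. -/
def Sgrp (J : NonUnitalSubalgebra F R) (lam : ↥J →ₗ[F] F) : Subgroup ↥(algGroup F R J) :=
  algSubgroup (sone J lam) J

/-- `L̄_λ = 1 + 𝔩̄_λ` as a subgroup of `G`. -/
def Lbarg (J : NonUnitalSubalgebra F R) (lam : ↥J →ₗ[F] F) : Subgroup ↥(algGroup F R J) :=
  algSubgroup (lbar J lam) J

/-- `S̄_λ = 1 + 𝔰̄_λ` as a subgroup of `G`. -/
def Sbarg (J : NonUnitalSubalgebra F R) (lam : ↥J →ₗ[F] F) : Subgroup ↥(algGroup F R J) :=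
  algSubgroup (sbar J lam) J

/-- Passing from an element of the subgroup `1 + k ≤ 1 + J` to an element of the
algebra group `1 + k` in its own right. -/
def toAlg {k J : NonUnitalSubalgebra F R} (x : ↥(algSubgroup k J)) : ↥(algGroup F R k) :=
  ⟨((x : ↥(algGroup F R J)) : Rˣ), Subgroup.mem_subgroupOf.mp x.2⟩

/-- The linear inclusion of a smaller subalgebra. -/
def inclMap {s J : NonUnitalSubalgebra F R} (h : s ≤ J) : ↥s →ₗ[F] ↥J where
  toFun x := ⟨(x : R), h x.2⟩
  map_add' x y := rfl
  map_smul' c x := rfl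

/-- Restriction of a functional on `J` to a smaller subalgebra. -/
def resTo {s J : NonUnitalSubalgebra F R} (h : s ≤ J) (lam : ↥J →ₗ[F] F) : ↥s →ₗ[F] F :=
  lam.comp (inclMap h)

/-- The character `ξ_λ = Ind_{L̄_λ}^G (θ_λ)`. -/
def xi (θ : AddChar F ℂ) (J : NonUnitalSubalgebra F R) (lam : ↥J →ₗ[F] F) :
    ↥(algGroup F R J) → ℂ :=
  indFun (Lbarg J lam) (fun x => thetaFn θ J lam ↑x)

/-- The set `Ξ_λ = {g λ s g⁻¹ : g ∈ G, s ∈ S̄_λ}`. -/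
def Xi (J : NonUnitalSubalgebra F R) (lam : ↥J →ₗ[F] F) : Set (↥J →ₗ[F] F) :=
  {nu | ∃ g : ↥(algGroup F R J), ∃ s ∈ Sbarg J lam, nu = coAct g (rightAct s lam)}

/-! ### Normality of algebra subgroups coming from ideals -/

theorem conj_mem_aux (s a : NonUnitalSubalgebra F R)
    (hl : ∀ x ∈ s, ∀ y ∈ a, x * y ∈ a) (hr : ∀ y ∈ a, ∀ x ∈ s, y * x ∈ a)
    (u : Rˣ) (hu1 : (u : R) - 1 ∈ s) (hu2 : ((u⁻¹ : Rˣ) : R) - 1 ∈ s)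
    (x : Rˣ) (hx : (x : R) - 1 ∈ a) : ((u * x * u⁻¹ : Rˣ) : R) - 1 ∈ a := by
  have h1 : (u : R) * ((u⁻¹ : Rˣ) : R) = 1 := Units.mul_inv u
  have key : ((u * x * u⁻¹ : Rˣ) : R) - 1 =
      ((u : R) - 1) * ((x : R) - 1) * (((u⁻¹ : Rˣ) : R) - 1) +
        ((u : R) - 1) * ((x : R) - 1) + ((x : R) - 1) * (((u⁻¹ : Rˣ) : R) - 1) +
        ((x : R) - 1) := by
    push_cast
    calc (u : R) * (x : R) * ((u⁻¹ : Rˣ) : R) - 1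
        = (u : R) * (x : R) * ((u⁻¹ : Rˣ) : R) - (u : R) * ((u⁻¹ : Rˣ) : R) := by rw [h1]
      _ = _ := by noncomm_ring
  rw [key]
  exact add_mem (add_mem (add_mem (hr _ (hl _ hu1 _ hx) _ hu2) (hl _ hu1 _ hx))
    (hr _ hx _ hu2)) hx

theorem algSubgroup_normal (s a : NonUnitalSubalgebra F R)
    (hl : ∀ x ∈ s, ∀ y ∈ a, x * y ∈ a) (hr : ∀ y ∈ a, ∀ x ∈ s, y * x ∈ a) :
    ((algGroup F R a).subgroupOf (algGroup F R s)).Normal := by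
  constructor
  intro n hn g
  rw [Subgroup.mem_subgroupOf] at hn ⊢
  have hginv : ((g⁻¹ : ↥(algGroup F R s)) : Rˣ) = ((g : Rˣ))⁻¹ := rfl
  have hcoe : ((g * n * g⁻¹ : ↥(algGroup F R s)) : Rˣ) = (g : Rˣ) * (n : Rˣ) * ((g : Rˣ))⁻¹ := by
    push_cast [hginv]; rfl
  rw [mem_algGroup]
  constructor
  · rw [hcoe]
    exact conj_mem_aux s a hl hr (g : Rˣ) (g : ↥(algGroup F R s)).2.1 (g : ↥(algGroup F R s)).2.2
      (n : Rˣ) hn.1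
  · have hinv : (((g * n * g⁻¹ : ↥(algGroup F R s)) : Rˣ))⁻¹ =
        (g : Rˣ) * ((n : Rˣ))⁻¹ * ((g : Rˣ))⁻¹ := by
      rw [hcoe]; group
    rw [hinv]
    exact conj_mem_aux s a hl hr (g : Rˣ) (g : ↥(algGroup F R s)).2.1 (g : ↥(algGroup F R s)).2.2
      ((n : Rˣ))⁻¹ hn.2

theorem lone_mul_mem (J : NonUnitalSubalgebra F R) (lam : ↥J →ₗ[F] F)
    {y z : R} (hy : y ∈ lone J lam) (hz : z ∈ J) : y * z ∈ lone J lam := by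
  refine ⟨J.mul_mem (lone_le J lam hy) hz, fun w hw => ?_⟩
  rw [mul_assoc]
  exact hy.2 (z * w) (J.mul_mem hz hw)

theorem sone_mul_lone_mem (J : NonUnitalSubalgebra F R) (lam : ↥J →ₗ[F] F)
    {x y : R} (hx : x ∈ sone J lam) (hy : y ∈ lone J lam) : x * y ∈ lone J lam := by
  refine ⟨J.mul_mem (sone_le J lam hx) (lone_le J lam hy), fun w hw => ?_⟩
  rw [mul_assoc]
  exact hx.2 (y * w) (lone_mul_mem J lam hy hw)

theorem kone_ideal_left (J : NonUnitalSubalgebra F R) (lam : ↥J →ₗ[F] F) :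
    ∀ x ∈ sone J lam, ∀ y ∈ kone J lam, x * y ∈ kone J lam := by
  intro x hx y hy
  exact ⟨sone_mul_lone_mem J lam hx hy.1, hx.2 y hy.1⟩

theorem kone_ideal_right (J : NonUnitalSubalgebra F R) (lam : ↥J →ₗ[F] F) :
    ∀ y ∈ kone J lam, ∀ x ∈ sone J lam, y * x ∈ kone J lam := by
  intro y hy x hx
  exact ⟨lone_mul_mem J lam hy.1 (sone_le J lam hx), hy.1.2 x (sone_le J lam hx)⟩

/-- `K_λ = 1 + 𝔨_λ` as a (normal) subgroup of `S_λ = 1 + 𝔰_λ`. -/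
def KgrpIn (J : NonUnitalSubalgebra F R) (lam : ↥J →ₗ[F] F) :
    Subgroup ↥(algGroup F R (sone J lam)) :=
  (algGroup F R (kone J lam)).subgroupOf (algGroup F R (sone J lam))

instance KgrpIn_normal (J : NonUnitalSubalgebra F R) (lam : ↥J →ₗ[F] F) :
    (KgrpIn J lam).Normal :=
  algSubgroup_normal (sone J lam) (kone J lam) (kone_ideal_left J lam) (kone_ideal_right J lam)

/-- `L_λ = 1 + 𝔩_λ` as a (normal) subgroup of `S_λ = 1 + 𝔰_λ`. -/
def LgrpIn (J : NonUnitalSubalgebra F R) (lam : ↥J →ₗ[F] F) :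
    Subgroup ↥(algGroup F R (sone J lam)) :=
  (algGroup F R (lone J lam)).subgroupOf (algGroup F R (sone J lam))

instance LgrpIn_normal (J : NonUnitalSubalgebra F R) (lam : ↥J →ₗ[F] F) :
    (LgrpIn J lam).Normal :=
  algSubgroup_normal (sone J lam) (lone J lam)
    (fun x hx y hy => sone_mul_lone_mem J lam hx hy)
    (fun y hy x hx => lone_mul_mem J lam hy (sone_le J lam hx))

/-! ### Algebra groups of nilpotent algebras -/

theorem IsNil.mono {k J : NonUnitalSubalgebra F R} (hJ : IsNil J) (h : k ≤ J) : IsNil k := by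
  obtain ⟨N, hN⟩ := hJ
  exact ⟨N, fun l hl => hN l fun x hx => h (hl x hx)⟩

theorem IsNil.isNilpotent {J : NonUnitalSubalgebra F R} (hJ : IsNil J) {x : R} (hx : x ∈ J) :
    IsNilpotent x := by
  obtain ⟨N, hN⟩ := hJ
  refine ⟨N, ?_⟩
  have h := hN (List.replicate N x) (fun y hy => (List.eq_of_mem_replicate hy) ▸ hx) (by simp)
  simpa using h

theorem pow_sub_one_mem (J : NonUnitalSubalgebra F R) {x : R} (hx : x - 1 ∈ J) (n : ℕ) :
    x ^ n - 1 ∈ J := by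
  induction n with
  | zero => simp
  | succ n ih =>
    have h : x ^ (n + 1) - 1 = (x ^ n - 1) * (x - 1) + (x ^ n - 1) + (x - 1) := by
      rw [pow_succ]; noncomm_ring
    rw [h]
    exact add_mem (add_mem (mul_mem ih hx) ih) hx

/-- In a finite ring the condition on the inverse in `algGroup` is automatic. -/
theorem mem_algGroup_iff {J : NonUnitalSubalgebra F R} {u : Rˣ} :
    u ∈ algGroup F R J ↔ (u : R) - 1 ∈ J := by
  refine ⟨fun h => h.1, fun h => ⟨h, ?_⟩⟩
  have hinv : u⁻¹ = u ^ (orderOf u - 1) := by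
    rw [inv_eq_iff_mul_eq_one, ← pow_succ', Nat.sub_add_cancel (orderOf_pos u),
      pow_orderOf_eq_one]
  rw [hinv, Units.val_pow_eq_pow_val]
  exact pow_sub_one_mem J h _

theorem exists_unit_sub_one_eq {J : NonUnitalSubalgebra F R} (hJ : IsNil J) {x : R}
    (hx : x ∈ J) : ∃ u ∈ algGroup F R J, (u : R) - 1 = x := by
  obtain ⟨u, hu⟩ := (hJ.isNilpotent hx).isUnit_one_add
  have h : (u : R) - 1 = x := by rw [hu]; abel
  exact ⟨u, mem_algGroup_iff.2 (h ▸ hx), h⟩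

theorem gElt_bijective {J : NonUnitalSubalgebra F R} (hJ : IsNil J) :
    Function.Bijective (gElt : ↥(algGroup F R J) → ↥J) := by
  constructor
  · intro g h hgh
    have h1 := congrArg Subtype.val hgh
    exact Subtype.ext (Units.ext (sub_left_injective h1))
  · rintro ⟨x, hx⟩
    obtain ⟨u, hu, hux⟩ := exists_unit_sub_one_eq hJ hx
    exact ⟨⟨u, hu⟩, Subtype.ext hux⟩

theorem mem_algSubgroup {k J : NonUnitalSubalgebra F R} {g : ↥(algGroup F R J)} :
    g ∈ algSubgroup k J ↔ ((gElt g : ↥J) : R) ∈ k := by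
  rw [algSubgroup, Subgroup.mem_subgroupOf, mem_algGroup_iff]
  rfl

theorem card_eq_of_mem_iff {J : NonUnitalSubalgebra F R} (hJ : IsNil J)
    {P : Submodule F ↥J} {H : Subgroup ↥(algGroup F R J)} (hH : ∀ g, g ∈ H ↔ gElt g ∈ P) :
    Nat.card ↥H = Nat.card ↥P :=
  Nat.card_congr ((Equiv.ofBijective _ (gElt_bijective hJ)).subtypeEquiv hH)

/-! ### The coadjoint action -/

theorem coAct_apply {J : NonUnitalSubalgebra F R} (g : ↥(algGroup F R J)) (mu : ↥J →ₗ[F] F)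
    (x : ↥J) (y : ↥J) (hy : (y : R) = ((g : Rˣ) : R) * (x : R) * (((g : Rˣ)⁻¹ : Rˣ) : R)) :
    coAct g mu x = mu y := by
  have : lmulMap g (rmulMap g⁻¹ x) = y := by
    apply Subtype.ext
    rw [hy, mul_assoc]
    rfl
  rw [← this]
  rfl

theorem gElt_conj {J : NonUnitalSubalgebra F R} (x g : ↥(algGroup F R J)) :
    ((gElt (x * g * x⁻¹) : ↥J) : R) =
      ((x : Rˣ) : R) * ((gElt g : ↥J) : R) * (((x : Rˣ)⁻¹ : Rˣ) : R) := by
  simp [gElt, mul_sub, sub_mul]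

theorem thetaFn_conj {J : NonUnitalSubalgebra F R} (θ : AddChar F ℂ) (mu : ↥J →ₗ[F] F)
    (x g : ↥(algGroup F R J)) :
    thetaFn θ J mu (x * g * x⁻¹) = thetaFn θ J (coAct x mu) g := by
  rw [thetaFn, thetaFn, coAct_apply x mu _ _ (gElt_conj x g)]

theorem coAct_one {J : NonUnitalSubalgebra F R} (mu : ↥J →ₗ[F] F) : coAct 1 mu = mu := by
  ext x
  exact coAct_apply _ _ _ _ (by simp)

theorem coAct_coAct {J : NonUnitalSubalgebra F R} (g h : ↥(algGroup F R J))
    (mu : ↥J →ₗ[F] F) : coAct g (coAct h mu) = coAct (h * g) mu := by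
  ext x
  rw [coAct_apply (h * g) mu x (lmulMap h (rmulMap h⁻¹ (lmulMap g (rmulMap g⁻¹ x))))]
  · rfl
  · simp [lmulMap, rmulMap, mul_assoc]

/-- The coadjoint action of a fixed group element as a permutation of the dual space. -/
def coActEquiv {J : NonUnitalSubalgebra F R} (g : ↥(algGroup F R J)) :
    (↥J →ₗ[F] F) ≃ (↥J →ₗ[F] F) where
  toFun := coAct g
  invFun := coAct g⁻¹
  left_inv mu := by rw [coAct_coAct, mul_inv_cancel, coAct_one]
  right_inv mu := by rw [coAct_coAct, inv_mul_cancel, coAct_one]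

/-! ### Additive character sums -/

theorem sum_addChar_linear {V : Type} [AddCommGroup V] [Module F V] [Fintype V]
    {θ : AddChar F ℂ} (hθ : θ ≠ 1) (κ : V →ₗ[F] F) :
    ∑ v, θ (κ v) = if κ = 0 then (Fintype.card V : ℂ) else 0 := by
  have h := AddChar.sum_eq_ite (θ.compAddMonoidHom κ.toAddMonoidHom)
  have hiff : θ.compAddMonoidHom κ.toAddMonoidHom = 0 ↔ κ = 0 := by
    constructor
    · intro h0
      by_contra hκ
      apply hθ
      ext a
      obtain ⟨v, rfl⟩ := LinearMap.surjective hκ a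
      exact DFunLike.congr_fun h0 v
    · rintro rfl
      ext v
      simp
  simp only [hiff] at h
  exact h

instance dualFinite (J : NonUnitalSubalgebra F R) : Finite (↥J →ₗ[F] F) :=
  DFunLike.finite _

instance dualFintype (J : NonUnitalSubalgebra F R) : Fintype (↥J →ₗ[F] F) :=
  Fintype.ofFinite _

/-- The functions `θ_μ` are orthonormal. -/
theorem innerG_thetaFn {J : NonUnitalSubalgebra F R} (hJ : IsNil J) {θ : AddChar F ℂ}
    (hθ : θ ≠ 1) (mu nu : ↥J →ₗ[F] F) :
    innerG ↥(algGroup F R J) (thetaFn θ J mu) (thetaFn θ J nu) = if mu = nu then 1 else 0 := by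
  have hb := gElt_bijective hJ
  rw [innerG, finsum_eq_sum_of_fintype]
  have h1 : ∑ x, thetaFn θ J mu x * (starRingEnd ℂ) (thetaFn θ J nu x) =
      ∑ v : ↥J, θ ((mu - nu) v) := by
    rw [← hb.sum_comp]
    refine Finset.sum_congr rfl fun x _ => ?_
    rw [thetaFn, thetaFn, ← AddChar.map_neg_eq_conj, ← AddChar.map_add_eq_mul,
      LinearMap.sub_apply, sub_eq_add_neg]
  rw [h1, sum_addChar_linear hθ, Nat.card_eq_of_bijective _ hb, Nat.card_eq_fintype_card]
  simp only [sub_eq_zero]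
  split_ifs
  · exact inv_mul_cancel₀ (Nat.cast_ne_zero.2 Fintype.card_ne_zero)
  · simp

/-- The functionals agreeing with `lam` on `P`. -/
def agreeing {J : NonUnitalSubalgebra F R} (P : Submodule F ↥J) (lam : ↥J →ₗ[F] F) :
    Finset (↥J →ₗ[F] F) :=
  {mu | ∀ x ∈ P, mu x = lam x}

theorem mem_agreeing {J : NonUnitalSubalgebra F R} {P : Submodule F ↥J}
    {lam mu : ↥J →ₗ[F] F} : mu ∈ agreeing P lam ↔ ∀ x ∈ P, mu x = lam x := by
  simp [agreeing]

theorem sum_agreeing {J : NonUnitalSubalgebra F R} (P : Submodule F ↥J) (lam : ↥J →ₗ[F] F)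
    (f : (↥J →ₗ[F] F) → ℂ) :
    ∑ mu ∈ agreeing P lam, f mu = ∑ κ : ↥(P.dualAnnihilator), f (lam + κ) := by
  symm
  refine Finset.sum_bij (fun κ _ => lam + (κ : ↥J →ₗ[F] F)) ?_ ?_ ?_ ?_
  · intro κ _
    rw [mem_agreeing]
    intro x hx
    simp [(Submodule.mem_dualAnnihilator _).1 κ.2 x hx]
  · intro a _ b _ hab
    exact Subtype.ext (add_left_cancel hab)
  · intro mu hmu
    rw [mem_agreeing] at hmu
    refine ⟨⟨mu - lam, (Submodule.mem_dualAnnihilator _).2 fun x hx => ?_⟩,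
      Finset.mem_univ _, by simp⟩
    simp [hmu x hx]
  · intros
    rfl

theorem card_agreeing {J : NonUnitalSubalgebra F R} (P : Submodule F ↥J)
    (lam : ↥J →ₗ[F] F) : (agreeing P lam).card = Nat.card ↥(P.dualAnnihilator) := by
  have h := sum_agreeing P lam 1
  simp only [Pi.one_apply, Finset.sum_const, nsmul_eq_mul, mul_one, Finset.card_univ] at h
  rw [Nat.card_eq_fintype_card]
  exact_mod_cast h

theorem card_mul_card_agreeing {J : NonUnitalSubalgebra F R} (P : Submodule F ↥J)
    (lam : ↥J →ₗ[F] F) : Nat.card ↥P * (agreeing P lam).card = Nat.card ↥J := by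
  rw [card_agreeing, Module.natCard_eq_pow_finrank (K := F) (V := ↥P),
    Module.natCard_eq_pow_finrank (K := F) (V := ↥(P.dualAnnihilator)),
    Module.natCard_eq_pow_finrank (K := F) (V := ↥J), ← pow_add,
    Subspace.finrank_add_finrank_dualAnnihilator_eq]

theorem sum_agreeing_addChar {J : NonUnitalSubalgebra F R} {θ : AddChar F ℂ} (hθ : θ ≠ 1)
    (P : Submodule F ↥J) (lam : ↥J →ₗ[F] F) (x : ↥J) :
    ∑ mu ∈ agreeing P lam, θ (mu x) =
      if x ∈ P then ((agreeing P lam).card : ℂ) * θ (lam x) else 0 := by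
  split_ifs with hx
  · rw [Finset.sum_congr rfl fun mu hmu => by rw [mem_agreeing.1 hmu x hx],
      Finset.sum_const, nsmul_eq_mul]
  · rw [sum_agreeing]
    simp only [LinearMap.add_apply, AddChar.map_add_eq_mul]
    rw [← Finset.mul_sum]
    have h := sum_addChar_linear (V := ↥P.dualAnnihilator) hθ
      ((Module.Dual.eval F ↥J x).domRestrict P.dualAnnihilator)
    rw [if_neg] at h
    · simp only [LinearMap.domRestrict_apply, Module.Dual.eval_apply] at h
      exact mul_eq_zero_of_right _ h
    · intro h0
      obtain ⟨κ, hκ, hle⟩ := Submodule.exists_le_ker_of_notMem hx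
      exact hκ (LinearMap.congr_fun h0
        ⟨κ, (Submodule.mem_dualAnnihilator _).2 fun y hy => hle hy⟩)

/-! ### Inducing `θ_λ` from an algebra subgroup -/

/-- The coefficient of `θ_ν` in the function induced from `θ_λ` on the algebra subgroup
`1 + P`: the proportion of `x ∈ G` for which `ν^x` agrees with `λ` on `P`. -/
def indCoeff {J : NonUnitalSubalgebra F R} (P : Submodule F ↥J) (lam nu : ↥J →ₗ[F] F) : ℝ :=
  (Nat.card ↥(algGroup F R J) : ℝ)⁻¹ *
    ∑ x : ↥(algGroup F R J), if coAct x nu ∈ agreeing P lam then 1 else 0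

theorem indCoeff_nonneg {J : NonUnitalSubalgebra F R} (P : Submodule F ↥J)
    (lam nu : ↥J →ₗ[F] F) : 0 ≤ indCoeff P lam nu :=
  mul_nonneg (by positivity) (Finset.sum_nonneg fun x _ => by split_ifs <;> norm_num)

theorem indCoeff_coAct {J : NonUnitalSubalgebra F R} (P : Submodule F ↥J)
    (lam nu : ↥J →ₗ[F] F) (g : ↥(algGroup F R J)) :
    indCoeff P lam (coAct g nu) = indCoeff P lam nu := by
  rw [indCoeff, indCoeff, ← Equiv.sum_comp (Equiv.mulLeft g) fun x =>
    if coAct x nu ∈ agreeing P lam then (1 : ℝ) else 0]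
  refine congrArg _ (Finset.sum_congr rfl fun x _ => ?_)
  rw [coAct_coAct]
  rfl

theorem indFun_thetaFn {J : NonUnitalSubalgebra F R} (hJ : IsNil J) {θ : AddChar F ℂ}
    (hθ : θ ≠ 1) (P : Submodule F ↥J) (H : Subgroup ↥(algGroup F R J))
    (hH : ∀ g, g ∈ H ↔ gElt g ∈ P) (lam : ↥J →ₗ[F] F) (g : ↥(algGroup F R J)) :
    indFun H (fun x => thetaFn θ J lam ↑x) g =
      ∑ nu, (indCoeff P lam nu : ℂ) * thetaFn θ J nu g := by
  have hA : ((agreeing P lam).card : ℂ) ≠ 0 :=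
    Nat.cast_ne_zero.2 (Finset.card_ne_zero.2 ⟨lam, mem_agreeing.2 fun _ _ => rfl⟩)
  have hHA : (Nat.card ↥H : ℂ) * (agreeing P lam).card = Nat.card ↥(algGroup F R J) := by
    rw [card_eq_of_mem_iff hJ hH, Nat.card_eq_of_bijective _ (gElt_bijective hJ)]
    exact_mod_cast card_mul_card_agreeing P lam
  have hterm : ∀ x : ↥(algGroup F R J),
      (if h : x * g * x⁻¹ ∈ H then thetaFn θ J lam (x * g * x⁻¹) else 0) =
        ((agreeing P lam).card : ℂ)⁻¹ *
          ∑ nu, if coAct x⁻¹ nu ∈ agreeing P lam then thetaFn θ J nu g else 0 := by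
    intro x
    have h1 := sum_agreeing_addChar hθ P lam (gElt (x * g * x⁻¹))
    have h2 : (∑ nu, if coAct x⁻¹ nu ∈ agreeing P lam then thetaFn θ J nu g else 0) =
        ∑ mu ∈ agreeing P lam, θ (mu (gElt (x * g * x⁻¹))) := by
      rw [← Equiv.sum_comp (coActEquiv x⁻¹).symm, ← Finset.sum_filter]
      have hmem : ∀ mu, coAct x⁻¹ ((coActEquiv x⁻¹).symm mu) = mu :=
        (coActEquiv x⁻¹).apply_symm_apply
      simp only [hmem, Finset.filter_univ_mem]
      refine Finset.sum_congr rfl fun mu _ => ?_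
      have hx : (coActEquiv x⁻¹).symm mu = coAct x mu := by
        change coAct x⁻¹⁻¹ mu = _
        rw [inv_inv]
      rw [hx, ← thetaFn_conj]
      rfl
    rw [h2, h1, dite_eq_ite]
    simp only [← hH]
    split_ifs
    · rw [inv_mul_cancel_left₀ hA]; rfl
    · simp
  have hdef : indFun H (fun x => thetaFn θ J lam ↑x) g = (Nat.card ↥H : ℂ)⁻¹ *
      ∑ x : ↥(algGroup F R J),
        if h : x * g * x⁻¹ ∈ H then thetaFn θ J lam (x * g * x⁻¹) else 0 := by
    rw [indFun, finsum_eq_sum_of_fintype]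
  rw [hdef, Finset.sum_congr rfl fun x _ => hterm x, ← Finset.mul_sum, ← mul_assoc,
    ← mul_inv, hHA, Finset.sum_comm, Finset.mul_sum]
  refine Finset.sum_congr rfl fun nu _ => ?_
  rw [indCoeff, ← Equiv.sum_comp (Equiv.inv ↥(algGroup F R J)) fun x =>
    if coAct x nu ∈ agreeing P lam then (1 : ℝ) else 0]
  push_cast
  rw [mul_assoc, Finset.sum_mul]
  refine congrArg _ (Finset.sum_congr rfl fun x _ => ?_)
  rw [Equiv.inv_apply]
  split_ifs <;> simp

theorem innerG_sum_thetaFn {J : NonUnitalSubalgebra F R} (hJ : IsNil J) {θ : AddChar F ℂ}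
    (hθ : θ ≠ 1) (c : (↥J →ₗ[F] F) → ℝ) {f : ↥(algGroup F R J) → ℂ}
    (hf : ∀ g, f g = ∑ nu, (c nu : ℂ) * thetaFn θ J nu g) :
    innerG ↥(algGroup F R J) f f = ((∑ nu, c nu ^ 2 : ℝ) : ℂ) := by
  have h : innerG ↥(algGroup F R J) f f = ∑ mu, ∑ nu, (c mu : ℂ) * c nu *
      innerG ↥(algGroup F R J) (thetaFn θ J mu) (thetaFn θ J nu) := by
    simp only [innerG, finsum_eq_sum_of_fintype, hf, map_sum, map_mul, Complex.conj_ofReal,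
      Finset.sum_mul_sum]
    simp only [Finset.mul_sum]
    rw [Finset.sum_comm]
    refine Finset.sum_congr rfl fun mu _ => ?_
    rw [Finset.sum_comm]
    refine Finset.sum_congr rfl fun nu _ => Finset.sum_congr rfl fun x _ => ?_
    ring
  rw [h]
  simp only [innerG_thetaFn hJ hθ]
  push_cast
  simp [sq]

theorem sum_sq_indCoeff {J : NonUnitalSubalgebra F R} (P : Submodule F ↥J)
    (lam : ↥J →ₗ[F] F) :
    ∑ nu, indCoeff P lam nu ^ 2 = ∑ mu ∈ agreeing P lam, indCoeff P lam mu := by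
  have hG : (Nat.card ↥(algGroup F R J) : ℝ) ≠ 0 := Nat.cast_ne_zero.2 Nat.card_pos.ne'
  have h1 : ∀ nu, indCoeff P lam nu ^ 2 = (Nat.card ↥(algGroup F R J) : ℝ)⁻¹ *
      ∑ x : ↥(algGroup F R J),
        if coAct x nu ∈ agreeing P lam then indCoeff P lam (coAct x nu) else 0 := by
    intro nu
    simp only [indCoeff_coAct]
    rw [sq]
    nth_rewrite 1 [indCoeff]
    rw [mul_assoc, Finset.sum_mul]
    simp
  have h2 : ∀ x : ↥(algGroup F R J),
      (∑ nu, if coAct x nu ∈ agreeing P lam then indCoeff P lam (coAct x nu) else 0) =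
        ∑ mu ∈ agreeing P lam, indCoeff P lam mu := by
    intro x
    refine (Equiv.sum_comp (coActEquiv x) fun nu =>
      if nu ∈ agreeing P lam then indCoeff P lam nu else 0).trans ?_
    simp
  simp only [h1]
  rw [← Finset.mul_sum, Finset.sum_comm, Finset.sum_congr rfl fun x _ => h2 x,
    Finset.sum_const, Finset.card_univ, ← Nat.card_eq_fintype_card, nsmul_eq_mul,
    inv_mul_cancel_left₀ hG]

/-- A subgroup stabilising the functionals which agree with `λ` on `P` is no larger than
`1 + P` when the induced function has norm one. -/
theorem card_le_of_sum_sq_indCoeff {J : NonUnitalSubalgebra F R} (hJ : IsNil J)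
    (P : Submodule F ↥J) (lam : ↥J →ₗ[F] F) (h1 : ∑ nu, indCoeff P lam nu ^ 2 = 1)
    (S : Subgroup ↥(algGroup F R J))
    (hS : ∀ g ∈ S, ∀ mu ∈ agreeing P lam, coAct g mu ∈ agreeing P lam) :
    Nat.card ↥S ≤ Nat.card ↥P := by
  have hG : (0 : ℝ) < Nat.card ↥(algGroup F R J) := Nat.cast_pos.2 Nat.card_pos
  have hA : (0 : ℝ) < (agreeing P lam).card :=
    Nat.cast_pos.2 (Finset.card_pos.2 ⟨lam, mem_agreeing.2 fun _ _ => rfl⟩)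
  have hPA : (Nat.card ↥P : ℝ) * (agreeing P lam).card = Nat.card ↥(algGroup F R J) := by
    rw [Nat.card_eq_of_bijective _ (gElt_bijective hJ)]
    exact_mod_cast card_mul_card_agreeing P lam
  have hc : ∀ mu ∈ agreeing P lam,
      (Nat.card ↥(algGroup F R J) : ℝ)⁻¹ * Nat.card ↥S ≤ indCoeff P lam mu := by
    intro mu hmu
    rw [indCoeff]
    gcongr
    rw [← Finset.sum_filter, Finset.sum_const, nsmul_eq_mul, mul_one, Nat.card_eq_fintype_card,
      Fintype.card_subtype]
    exact_mod_cast Finset.card_le_card fun x hx => by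
      simp only [Finset.mem_filter, Finset.mem_univ, true_and] at hx ⊢
      exact hS x hx mu hmu
  have h2 := Finset.card_nsmul_le_sum _ _ _ hc
  rw [← sum_sq_indCoeff, h1, nsmul_eq_mul, ← hPA] at h2
  have hP : (0 : ℝ) < Nat.card ↥P := Nat.cast_pos.2 Nat.card_pos
  rw [mul_inv, mul_left_comm, mul_assoc, inv_mul_cancel_left₀ hA.ne', inv_mul_le_one₀ hP] at h2
  exact_mod_cast h2

/-- If all functionals agreeing with `λ` on `P` are conjugate to `λ` and the induced function
has norm one, then it is the Kirillov function. -/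
theorem sum_indCoeff_eq_kirillov {J : NonUnitalSubalgebra F R} (θ : AddChar F ℂ)
    (P : Submodule F ↥J) (lam : ↥J →ₗ[F] F) (h1 : ∑ nu, indCoeff P lam nu ^ 2 = 1)
    (hA : ∀ mu ∈ agreeing P lam, mu ∈ coOrbit J lam) (g : ↥(algGroup F R J)) :
    ∑ nu, (indCoeff P lam nu : ℂ) * thetaFn θ J nu g = kirillov θ J lam g := by
  have hout : ∀ nu, nu ∉ coOrbit J lam → indCoeff P lam nu = 0 := by
    intro nu hnu
    rw [indCoeff, Finset.sum_eq_zero, mul_zero]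
    intro x _
    rw [if_neg]
    intro hx
    obtain ⟨y, hy⟩ := hA _ hx
    refine hnu ⟨y * x⁻¹, ?_⟩
    have h2 : coAct x⁻¹ (coAct y lam) = coAct x⁻¹ (coAct x nu) := congrArg _ hy
    rw [coAct_coAct, coAct_coAct, mul_inv_cancel, coAct_one] at h2
    exact h2
  have hin : ∀ nu ∈ coOrbit J lam, indCoeff P lam nu = indCoeff P lam lam := by
    rintro _ ⟨y, rfl⟩
    exact indCoeff_coAct P lam lam y
  have hcases : ∀ nu, indCoeff P lam nu =
      if nu ∈ coOrbit J lam then indCoeff P lam lam else 0 := by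
    intro nu
    split_ifs with h
    · exact hin nu h
    · exact hout nu h
  have hsq : (Nat.card ↥(coOrbit J lam) : ℝ) * indCoeff P lam lam ^ 2 = 1 := by
    rw [← h1, Nat.card_eq_fintype_card, Fintype.card_subtype, ← nsmul_eq_mul,
      ← Finset.sum_const, Finset.sum_filter]
    refine Finset.sum_congr rfl fun nu _ => ?_
    rw [hcases nu]
    split_ifs <;> simp
  have hsqrt : indCoeff P lam lam = (Real.sqrt (Nat.card ↥(coOrbit J lam)))⁻¹ := by
    rw [← Real.sqrt_inv, eq_comm, Real.sqrt_eq_iff_mul_self_eq (by positivity)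
      (indCoeff_nonneg P lam lam), ← sq]
    exact (eq_inv_of_mul_eq_one_right hsq).symm
  rw [kirillov, finsum_mem_eq_finite_toFinset_sum _ (Set.toFinite _), ← Complex.ofReal_inv,
    ← hsqrt, Finset.mul_sum]
  symm
  refine (Finset.sum_congr rfl fun nu hnu => ?_).trans
    (Finset.sum_subset (Finset.subset_univ _) fun nu _ hnu => ?_)
  · rw [hin nu ((Set.Finite.mem_toFinset _).1 hnu)]
  · rw [hout nu fun h => hnu ((Set.Finite.mem_toFinset _).2 h), Complex.ofReal_zero, zero_mul]

/-! ### Conjugating functionals along one step of the chain -/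

theorem exists_eq_mul_right (s M : Submodule F R) (Λ f : R →ₗ[F] F)
    (h : ∀ x ∈ s, (∀ y ∈ M, Λ (x * y) = 0) → f x = 0) :
    ∃ y ∈ M, ∀ x ∈ s, f x = Λ (x * y) := by
  let Φ : ↥M →ₗ[F] (↥s →ₗ[F] F) :=
    { toFun := fun y => (Λ.comp (LinearMap.mulRight F (y : R))).comp s.subtype
      map_add' := fun y z => by ext x; simp [mul_add]
      map_smul' := fun c y => by ext x; simp }
  have hmem : f.comp s.subtype ∈ Submodule.span F (Set.range Φ) := by
    refine mem_span_of_iInf_ker_le_ker fun x hx => ?_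
    rw [Submodule.mem_iInf] at hx
    exact h x x.2 fun y hy => hx ⟨y, hy⟩
  rw [← LinearMap.coe_range, Submodule.span_eq] at hmem
  obtain ⟨y, hy⟩ := hmem
  exact ⟨y, y.2, fun x hx => (LinearMap.congr_fun hy ⟨x, hx⟩).symm⟩

theorem exists_conj_eq {s l s' : NonUnitalSubalgebra F R} (hs : IsNil s) (Λ N N' : R →ₗ[F] F)
    (hl : ∀ x, x ∈ l ↔ x ∈ s ∧ ∀ y ∈ s, Λ (x * y) = 0)
    (hs' : ∀ x ∈ s, (∀ y ∈ l, Λ (x * y) = 0) → x ∈ s')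
    (hN : ∀ x ∈ l, N x = Λ x) (hNN' : ∀ x ∈ s', N x = N' x) :
    ∃ u ∈ algGroup F R l, ∀ x ∈ s, N ((u : R) * x * ((u⁻¹ : Rˣ) : R)) = N' x := by
  have hls : l ≤ s := fun x hx => ((hl x).1 hx).1
  obtain ⟨y, hy, hNy⟩ := exists_eq_mul_right s.toSubmodule s.toSubmodule Λ (N - Λ)
    fun x hx h => by simp [hN x ((hl x).2 ⟨hx, h⟩)]
  obtain ⟨z, hz, hNz⟩ := exists_eq_mul_right s.toSubmodule l.toSubmodule Λ (N' - N)
    fun x hx h => by simp [hNN' x (hs' x hx h)]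
  replace hy : y ∈ s := hy
  replace hz : z ∈ l := hz
  replace hNy : ∀ x ∈ s, N x = Λ x + Λ (x * y) := fun x hx => by
    rw [← hNy x hx, LinearMap.sub_apply]; abel
  replace hNz : ∀ x ∈ s, N' x = N x + Λ (x * z) := fun x hx => by
    rw [← hNz x hx, LinearMap.sub_apply]; abel
  obtain ⟨v, hv, hvy⟩ := exists_unit_sub_one_eq hs hy
  have hzv : z * ((v⁻¹ : Rˣ) : R) ∈ l := by
    refine (hl _).2 ⟨?_, fun t ht => ?_⟩
    · have h : z * ((v⁻¹ : Rˣ) : R) = z * (((v⁻¹ : Rˣ) : R) - 1) + z := by noncomm_ring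
      rw [h]
      exact add_mem (mul_mem (hls hz) hv.2) (hls hz)
    · have h : z * ((v⁻¹ : Rˣ) : R) * t = z * ((((v⁻¹ : Rˣ) : R) - 1) * t + t) := by
        noncomm_ring
      rw [h]
      exact ((hl z).1 hz).2 _ (add_mem (mul_mem hv.2 ht) ht)
  obtain ⟨w, hw, hwz⟩ := exists_unit_sub_one_eq (hs.mono hls) hzv
  refine ⟨w⁻¹, inv_mem hw, fun x hx => ?_⟩
  rw [inv_inv]
  have hxw : x * (w : R) ∈ s := by
    have h : x * (w : R) = x * ((w : R) - 1) + x := by noncomm_ring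
    rw [h]
    exact add_mem (mul_mem hx (hls hw.1)) hx
  have hxwv : x * (w : R) * (v : R) ∈ s := by
    have h : x * (w : R) * (v : R) = x * (w : R) * ((v : R) - 1) + x * (w : R) := by
      noncomm_ring
    rw [h]
    exact add_mem (mul_mem hxw hv.1) hxw
  have ht : ((w⁻¹ : Rˣ) : R) * x * (w : R) ∈ s := by
    have h : ((w⁻¹ : Rˣ) : R) * x * (w : R) =
        (((w⁻¹ : Rˣ) : R) - 1) * (x * (w : R)) + x * (w : R) := by noncomm_ring
    rw [h]
    exact add_mem (mul_mem (hls hw.2) hxw) hxw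
  have hwv : (w : R) * (v : R) = (v : R) + z := by
    have h : (w : R) = 1 + z * ((v⁻¹ : Rˣ) : R) := by rw [← hwz]; abel
    rw [h, add_mul, one_mul, mul_assoc, Units.inv_mul, mul_one]
  have hv1 : (v : R) = 1 + y := by rw [← hvy]; abel
  calc N (((w⁻¹ : Rˣ) : R) * x * (w : R))
      = Λ (((w⁻¹ : Rˣ) : R) * x * (w : R) * (v : R)) := by
        rw [hNy _ ht, ← map_add, hv1, mul_add, mul_one]
    _ = Λ ((((w⁻¹ : Rˣ) : R) - 1) * (x * (w : R) * (v : R))) + Λ (x * (w : R) * (v : R)) := by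
        rw [← map_add]; congr 1; noncomm_ring
    _ = Λ (x * (w : R) * (v : R)) := by rw [((hl _).1 hw.2).2 _ hxwv, zero_add]
    _ = Λ x + Λ (x * y) + Λ (x * z) := by
        rw [mul_assoc, hwv, hv1, mul_add, mul_add, mul_one, map_add, map_add]
    _ = N' x := by rw [hNz x hx, hNy x hx]

theorem exists_linear_extension {J : NonUnitalSubalgebra F R} (mu : ↥J →ₗ[F] F) :
    ∃ Λ : R →ₗ[F] F, ∀ x : ↥J, Λ x = mu x := by
  obtain ⟨Λ, hΛ⟩ := LinearMap.exists_extend (p := J.toSubmodule) mu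
  exact ⟨Λ, fun x => LinearMap.congr_fun hΛ x⟩

theorem exists_coAct_eq_on {J : NonUnitalSubalgebra F R} (hJ : IsNil J)
    (s : NonUnitalSubalgebra F R) (hs : s ≤ J) (lam mu nu : ↥J →ₗ[F] F)
    (hmu : ∀ x : ↥J, (x : R) ∈ lStep J lam s hs → mu x = lam x)
    (hmunu : ∀ x : ↥J, (x : R) ∈ sStep J lam s hs → mu x = nu x) :
    ∃ g ∈ algSubgroup (lStep J lam s hs) J, ∀ x : ↥J, (x : R) ∈ s → coAct g mu x = nu x := by
  obtain ⟨Λ, hΛ⟩ := exists_linear_extension lam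
  obtain ⟨N, hN⟩ := exists_linear_extension mu
  obtain ⟨N', hN'⟩ := exists_linear_extension nu
  have hE : ∀ x ∈ J, lamE J lam x = Λ x := fun x hx => by
    rw [lamE_apply J lam hx, ← hΛ ⟨x, hx⟩]
  have hlJ : lStep J lam s hs ≤ J := (lStep_le J lam s hs).trans hs
  obtain ⟨u, hu, hconj⟩ := exists_conj_eq (s := s) (l := lStep J lam s hs)
    (s' := sStep J lam s hs) (hJ.mono hs) Λ N N'
    (fun x => and_congr_right fun hx => forall₂_congr fun y hy => by
      rw [hE _ (mul_mem (hs hx) (hs hy))])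
    (fun x hx h => ⟨hx, fun y hy => by
      rw [hE _ (mul_mem (hs hx) (hlJ hy)), h y hy]⟩)
    (fun x hx => by
      rw [hN ⟨x, hlJ hx⟩, hΛ ⟨x, hlJ hx⟩, hmu ⟨x, hlJ hx⟩ hx])
    (fun x hx => by
      have hxJ := hs (sStep_le J lam s hs hx)
      rw [hN ⟨x, hxJ⟩, hN' ⟨x, hxJ⟩, hmunu ⟨x, hxJ⟩ hx])
  have huJ : u ∈ algGroup F R J := mem_algGroup_iff.2 (hlJ hu.1)
  refine ⟨⟨u, huJ⟩, Subgroup.mem_subgroupOf.2 hu, fun x hx => ?_⟩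
  rw [← hN' x, ← hconj x hx, mul_assoc]
  exact (hN (lmulMap ⟨u, huJ⟩ (rmulMap (⟨u, huJ⟩ : ↥(algGroup F R J))⁻¹ x))).symm

/-! ### Stabilisation of the chains -/

theorem sChain_stable_or_card_le (J : NonUnitalSubalgebra F R) (lam : ↥J →ₗ[F] F) (n : ℕ) :
    sChain J lam (n + 1) = sChain J lam n ∨
      Nat.card ↥(sChain J lam n) + n ≤ Nat.card R := by
  induction n with
  | zero => exact Or.inr (Nat.card_le_card_of_injective _ Subtype.val_injective)
  | succ n ih =>
    by_cases h : sChain J lam (n + 1) = sChain J lam n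
    · left
      have haux : sChainAux J lam (n + 1) = sChainAux J lam n := Subtype.ext h
      exact congrArg (fun t : {s : NonUnitalSubalgebra F R // s ≤ J} => sStep J lam t.1 t.2) haux
    · right
      have hle : sChain J lam (n + 1) ≤ sChain J lam n := sStep_le J lam _ _
      have hlt : Nat.card ↥(sChain J lam (n + 1)) < Nat.card ↥(sChain J lam n) :=
        Set.Finite.card_lt_card (Set.toFinite _) (lt_of_le_of_ne hle fun he => h (SetLike.coe_injective he))
      have := ih.resolve_left h
      omega

theorem sStep_sbar (J : NonUnitalSubalgebra F R) (lam : ↥J →ₗ[F] F) :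
    sStep J lam (sbar J lam) (sbar_le J lam) = sbar J lam := by
  refine (sChain_stable_or_card_le J lam (Fintype.card R)).resolve_right fun h => ?_
  have hpos : 0 < Nat.card ↥(sChain J lam (Fintype.card R)) := Nat.card_pos
  rw [Nat.card_eq_fintype_card (α := R)] at h
  omega

theorem lChain_mono (J : NonUnitalSubalgebra F R) (lam : ↥J →ₗ[F] F) :
    Monotone (lChain J lam) :=
  monotone_nat_of_le_succ fun n x hx =>
    ⟨⟨hx.1, fun y hy => hx.2 y hy.1⟩, fun y hy => hx.2 y hy.1⟩

/-! ### Functionals agreeing with `λ` on the terminal subalgebra -/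

/-- The subspace of `J` consisting of the elements lying in `k`. -/
def within (k J : NonUnitalSubalgebra F R) : Submodule F ↥J where
  carrier := {x | (x : R) ∈ k}
  zero_mem' := zero_mem k
  add_mem' {x y} hx hy := show (x : R) + (y : R) ∈ k from add_mem hx hy
  smul_mem' c x hx := show c • (x : R) ∈ k from SMulMemClass.smul_mem c hx

theorem coAct_mem_agreeing_of_mem_Sbarg {J : NonUnitalSubalgebra F R} (lam : ↥J →ₗ[F] F)
    {g : ↥(algGroup F R J)} (hg : g ∈ Sbarg J lam) {mu : ↥J →ₗ[F] F}
    (hmu : mu ∈ agreeing (within (lbar J lam) J) lam) :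
    coAct g mu ∈ agreeing (within (lbar J lam) J) lam := by
  rw [mem_agreeing] at hmu ⊢
  rintro ⟨x, hxJ⟩ hx
  replace hx : x ∈ lbar J lam := hx
  obtain ⟨ha, hb⟩ := Subgroup.mem_subgroupOf.1 hg
  set u : Rˣ := (g : Rˣ)
  have hright : ∀ y ∈ lbar J lam, ∀ b ∈ sbar J lam, y * b ∈ lbar J lam := fun y hy b hb =>
    ⟨mul_mem hy.1 hb, fun t ht => by rw [mul_assoc]; exact hy.2 _ (mul_mem hb ht)⟩
  have hzero : ∀ a ∈ sbar J lam, ∀ y ∈ lbar J lam, lamE J lam (a * y) = 0 := fun a ha y hy => by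
    rw [← sStep_sbar] at ha
    exact ha.2 y hy
  have hleft : ∀ a ∈ sbar J lam, ∀ y ∈ lbar J lam, a * y ∈ lbar J lam := fun a ha y hy =>
    ⟨mul_mem ha hy.1, fun t ht => by rw [mul_assoc]; exact hzero a ha _ (hright y hy t ht)⟩
  have hxb := hright x hx _ hb
  have haxb := hleft _ ha _ (add_mem hxb hx)
  have hconj : (u : R) * x * ((u⁻¹ : Rˣ) : R) =
      ((u : R) - 1) * (x * (((u⁻¹ : Rˣ) : R) - 1) + x) + (x * (((u⁻¹ : Rˣ) : R) - 1) + x) := by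
    noncomm_ring
  have hmem : (u : R) * x * ((u⁻¹ : Rˣ) : R) ∈ lbar J lam := by
    rw [hconj]
    exact add_mem haxb (add_mem hxb hx)
  have hle := lbar_le J lam
  rw [coAct_apply g mu ⟨x, hxJ⟩ ⟨_, hle hmem⟩ rfl, hmu ⟨_, hle hmem⟩ hmem,
    ← lamE_apply J lam, ← lamE_apply J lam, hconj,
    lamE_add J lam (hle haxb) (hle (add_mem hxb hx)), lamE_add J lam (hle hxb) (hle hx),
    hzero _ ha _ (add_mem hxb hx), hx.2 _ hb, zero_add, zero_add]

theorem lbar_le_sbar (J : NonUnitalSubalgebra F R) (lam : ↥J →ₗ[F] F) :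
    lbar J lam ≤ sbar J lam :=
  lStep_le J lam _ _

theorem algSubgroup_mono {k k' J : NonUnitalSubalgebra F R} (h : k ≤ k') :
    algSubgroup k J ≤ algSubgroup k' J :=
  fun _ hg => mem_algSubgroup.2 (h (mem_algSubgroup.1 hg))

theorem exists_coAct_eq_of_eq_on_sChain {J : NonUnitalSubalgebra F R} (hJ : IsNil J)
    (lam : ↥J →ₗ[F] F) {n : ℕ} (hn : n ≤ Fintype.card R) {mu nu : ↥J →ₗ[F] F}
    (hmu : mu ∈ agreeing (within (lbar J lam) J) lam)
    (h : ∀ x : ↥J, (x : R) ∈ sChain J lam n → mu x = nu x) : ∃ g, coAct g mu = nu := by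
  induction n generalizing mu with
  | zero => exact ⟨1, by rw [coAct_one]; exact LinearMap.ext fun x => h x x.2⟩
  | succ n ih =>
    have hll : lChain J lam n ≤ lbar J lam := lChain_mono J lam (Nat.le_of_succ_le hn)
    obtain ⟨g, hg, hgx⟩ := exists_coAct_eq_on hJ (sChainAux J lam n).1 (sChainAux J lam n).2
      lam mu nu (fun x hx => mem_agreeing.1 hmu x (hll hx)) h
    have hgS : g ∈ Sbarg J lam := algSubgroup_mono (hll.trans (lbar_le_sbar J lam)) hg
    obtain ⟨g', hg'⟩ := ih (Nat.le_of_succ_le hn) (coAct_mem_agreeing_of_mem_Sbarg lam hgS hmu) hgx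
    exact ⟨g * g', by rw [← coAct_coAct, hg']⟩

theorem statement11 (F : Type) [Field F] [Fintype F]
    (R : Type) [Ring R] [Algebra F R] [Fintype R]
    (J : NonUnitalSubalgebra F R) (hJ : IsNil J)
    (θ : AddChar F ℂ) (hθ : θ ≠ 1)
    (lam : ↥J →ₗ[F] F) (hirr : xi θ J lam ∈ Irr ↥(algGroup F R J)) :
    xi θ J lam = kirillov θ J lam := by
  set P := within (lbar J lam) J
  have hH : ∀ g, g ∈ Lbarg J lam ↔ gElt g ∈ P := fun g => mem_algSubgroup
  have hxi : ∀ g, xi θ J lam g = ∑ nu, (indCoeff P lam nu : ℂ) * thetaFn θ J nu g :=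
    indFun_thetaFn hJ hθ P (Lbarg J lam) hH lam
  have hnorm : ∑ nu, indCoeff P lam nu ^ 2 = 1 := by
    have h := hirr.2
    rw [innerG_sum_thetaFn hJ hθ _ hxi] at h
    exact_mod_cast h
  have hcard := card_le_of_sum_sq_indCoeff hJ P lam hnorm (Sbarg J lam)
    fun g hg mu hmu => coAct_mem_agreeing_of_mem_Sbarg lam hg hmu
  rw [← card_eq_of_mem_iff hJ hH] at hcard
  have hLS : Lbarg J lam = Sbarg J lam :=
    Subgroup.eq_of_le_of_card_ge (algSubgroup_mono (lbar_le_sbar J lam)) hcard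
  have hsl : ∀ x : ↥J, (x : R) ∈ sbar J lam → x ∈ P := by
    intro x hx
    obtain ⟨g, rfl⟩ := (gElt_bijective hJ).surjective x
    rw [← hH, hLS]
    exact mem_algSubgroup.2 hx
  funext g
  rw [hxi, sum_indCoeff_eq_kirillov θ P lam hnorm]
  intro mu hmu
  have hlam : lam ∈ agreeing P lam := mem_agreeing.2 fun _ _ => rfl
  exact exists_coAct_eq_of_eq_on_sChain hJ lam le_rfl hlam fun x hx =>
    (mem_agreeing.1 hmu x (hsl x hx)).symm


end IterChar
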